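/- Let P be a simple polygon with vertices v₀,…,v_{n−1} listed in counterclockwise order (positive shoelace signed area) such that no three consecutive vertices are collinear. For each i, let θᵢ ∈ (−π, π) be the signed angular turn at vᵢ, i.e., the signed angle from the direction vᵢ − vᵢ₋₁ to the direction vᵢ₊₁ − vᵢ (positive for a left turn, negative for a right turn). Then Σᵢ θᵢ = 2π. -/

import Mathlib

open scoped RealInnerProductSpace ENNReal Classical

noncomputable section

/-- Points of the Euclidean plane. -/
abbrev Pt : Type := EuclideanSpace ℝ (Fin 2)

/-- The planar determinant `det (u, v)` of two vectors. -/
def det2 (u v : Pt) : ℝ := u 0 * v 1 - u 1 * v 0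

/-- No three of the points of `S` are collinear. -/
def NoThreeCollinear (S : Set Pt) : Prop :=
  ∀ p ∈ S, ∀ q ∈ S, ∀ r ∈ S, p ≠ q → p ≠ r → q ≠ r → det2 (q - p) (r - p) ≠ 0

/-- `S` is in strong general position: no three points are collinear and for any four
distinct points `p₁ p₂ p₃ p₄` the line through `p₁,p₂` is not parallel to the line
through `p₃,p₄`. -/
def StrongGenPos (S : Set Pt) : Prop :=
  NoThreeCollinear S ∧
    ∀ p₁ ∈ S, ∀ p₂ ∈ S, ∀ p₃ ∈ S, ∀ p₄ ∈ S,
      p₁ ≠ p₂ → p₁ ≠ p₃ → p₁ ≠ p₄ → p₂ ≠ p₃ → p₂ ≠ p₄ → p₃ ≠ p₄ →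
        det2 (p₂ - p₁) (p₄ - p₃) ≠ 0

/-- A simple polygon, given by a cyclic sequence of `n ≥ 3` distinct vertices
(encoded as an `n`-periodic function `ℕ → Pt`), such that no point of the plane lies on
more than two closed edges, and the only points lying on exactly two edges are vertices. -/
structure SimplePolygon where
  n : ℕ
  three_le : 3 ≤ n
  vtx : ℕ → Pt
  periodic : ∀ i, vtx (i + n) = vtx i
  inj : ∀ i < n, ∀ j < n, vtx i = vtx j → i = j
  simple : ∀ x : Pt, {i | i < n ∧ x ∈ segment ℝ (vtx i) (vtx (i + 1))}.ncard ≤ 2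
  vtx_of_two : ∀ x : Pt,
    {i | i < n ∧ x ∈ segment ℝ (vtx i) (vtx (i + 1))}.ncard = 2 → ∃ i < n, x = vtx i

namespace SimplePolygon

/-- The boundary of a simple polygon: the union of its closed edges. -/
def boundary (P : SimplePolygon) : Set Pt :=
  ⋃ i ∈ Finset.range P.n, segment ℝ (P.vtx i) (P.vtx (i + 1))

/-- The interior of a simple polygon: the union of the bounded connected components of the
complement of the boundary. -/
def interior (P : SimplePolygon) : Set Pt :=
  {x | x ∉ P.boundary ∧ Bornology.IsBounded (connectedComponentIn P.boundaryᶜ x)}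

/-- A simple polygon, regarded as a point set: boundary together with interior. -/
def region (P : SimplePolygon) : Set Pt := P.boundary ∪ P.interior

/-- The set of vertices of the polygon. -/
def vertexSet (P : SimplePolygon) : Set Pt := {x | ∃ i < P.n, x = P.vtx i}

/-- Twice the shoelace signed area. -/
def shoelace (P : SimplePolygon) : ℝ := ∑ i ∈ Finset.range P.n, det2 (P.vtx i) (P.vtx (i + 1))

/-- The vertices are listed in counterclockwise order (positive shoelace signed area). -/
def CCW (P : SimplePolygon) : Prop := 0 < P.shoelace

/-- The vertex `vtx (i+1)` is a convex vertex:
`det (v_{i+1} − v_i, v_{i+2} − v_{i+1}) > 0` (vertices listed counterclockwise). -/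
def ConvexAt (P : SimplePolygon) (i : ℕ) : Prop :=
  0 < det2 (P.vtx (i + 1) - P.vtx i) (P.vtx (i + 2) - P.vtx (i + 1))

/-- The number of convex vertices of the polygon. -/
def numConvex (P : SimplePolygon) : ℕ := {i | i < P.n ∧ P.ConvexAt i}.ncard

/-- Continuous paths from `s` to `t` staying inside the polygon. -/
def pathsIn (P : SimplePolygon) (s t : Pt) : Set (ℝ → Pt) :=
  {γ | ContinuousOn γ (Set.Icc 0 1) ∧ γ 0 = s ∧ γ 1 = t ∧ γ '' Set.Icc (0 : ℝ) 1 ⊆ P.region}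

/-- The geodesic distance between `s` and `t` inside the polygon: the infimum of the
lengths (total variations) of continuous paths in the polygon from `s` to `t`. -/
def geodDist (P : SimplePolygon) (s t : Pt) : ℝ≥0∞ :=
  ⨅ γ ∈ P.pathsIn s t, eVariationOn γ (Set.Icc 0 1)

end SimplePolygon

/-- Length of a polygonal path through a list of points. -/
def polylineLen : List Pt → ℝ
  | [] => 0
  | [_] => 0
  | a :: b :: l => dist a b + polylineLen (b :: l)

/-- The polygonal path through a list of points, as a point set. -/
def polylineSet : List Pt → Set Pt
  | [] => ∅
  | [a] => {a}
  | a :: b :: l => segment ℝ a b ∪ polylineSet (b :: l)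

/-- `L` is the vertex sequence of the geodesic from `s` to `t` inside the polygon `P`:
a polygonal path inside `P` from `s` to `t`, with consecutive vertices distinct, with no
three consecutive vertices collinear, whose length realizes the geodesic distance. -/
def SimplePolygon.IsGeodesicChain (P : SimplePolygon) (s t : Pt) (L : List Pt) : Prop :=
  L.head? = some s ∧ L.getLast? = some t ∧ List.Chain' (· ≠ ·) L ∧
  (∀ i, i + 2 < L.length →
      det2 (L.getD (i + 1) 0 - L.getD i 0) (L.getD (i + 2) 0 - L.getD i 0) ≠ 0) ∧
  polylineSet L ⊆ P.region ∧
  ENNReal.ofReal (polylineLen L) = P.geodDist s t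

/-- The triple `(p,q,r)` is in geodesic counterclockwise order with respect to `P`:
writing the geodesics `π(p,q) = ⟨p = v₀, …, v_k = q⟩` and `π(p,r) = ⟨p = u₀, …, u_{k'} = r⟩`
and taking the smallest index `i > 0` with `v_i ≠ u_i`, we have
`det (v_i − v_{i−1}, u_i − v_{i−1}) > 0`. -/
def geodesicCCW (P : SimplePolygon) (p q r : Pt) : Prop :=
  ∃ L M : List Pt, P.IsGeodesicChain p q L ∧ P.IsGeodesicChain p r M ∧
    ∃ i : ℕ, 0 < i ∧ (∀ j < i, L[j]? = M[j]?) ∧ L[i]? ≠ M[i]? ∧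
      ∃ a b c : Pt, L[i - 1]? = some a ∧ L[i]? = some b ∧ M[i]? = some c ∧
        0 < det2 (b - a) (c - a)

/-- The triple `(p,q,r)` is in geodesic clockwise order with respect to `P`. -/
def geodesicCW (P : SimplePolygon) (p q r : Pt) : Prop :=
  ∃ L M : List Pt, P.IsGeodesicChain p q L ∧ P.IsGeodesicChain p r M ∧
    ∃ i : ℕ, 0 < i ∧ (∀ j < i, L[j]? = M[j]?) ∧ L[i]? ≠ M[i]? ∧
      ∃ a b c : Pt, L[i - 1]? = some a ∧ L[i]? = some b ∧ M[i]? = some c ∧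
        det2 (b - a) (c - a) < 0

/-- `C ⊆ P` is geodesically convex: for all `p, q ∈ C` the geodesic connecting them
stays inside `C`. -/
def GeodesicallyConvex (P : SimplePolygon) (C : Set Pt) : Prop :=
  C ⊆ P.region ∧ ∀ p ∈ C, ∀ q ∈ C, ∀ L, P.IsGeodesicChain p q L → polylineSet L ⊆ C

/-- The geodesic hull `CH_P(U)`: the intersection of all geodesically convex subsets of `P`
containing `U`. -/
def geodesicHull (P : SimplePolygon) (U : Set Pt) : Set Pt :=
  ⋂₀ {C | GeodesicallyConvex P C ∧ U ⊆ C}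

/-- `E_P(S)`: the set of points of `S` lying on the (topological) boundary of the geodesic
hull of `S` with respect to `P`. -/
def extremeSet (P : SimplePolygon) (S : Set Pt) : Set Pt :=
  {x ∈ S | x ∈ frontier (geodesicHull P S)}

/-- `B` is separable from `R`: there is a simple polygon with at most `|B|` convex vertices
whose interior contains all points of `R` and which contains no point of `B`. -/
def Separable (B R : Finset Pt) : Prop :=
  ∃ P : SimplePolygon, P.CCW ∧ P.numConvex ≤ B.card ∧
    (∀ r ∈ R, r ∈ P.interior) ∧ ∀ b ∈ B, b ∉ P.region

/-- The signed angular turn at the vertex `vtx (i+1)`: the signed angle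
`θ = arg((y₁ + i y₂)/(x₁ + i x₂)) ∈ (−π, π]` from the direction `x = v_{i+1} − v_i` to the
direction `y = v_{i+2} − v_{i+1}`. -/
def turnAngle (P : SimplePolygon) (i : ℕ) : ℝ :=
  Complex.arg
    ((⟨(P.vtx (i + 2) - P.vtx (i + 1)) 0, (P.vtx (i + 2) - P.vtx (i + 1)) 1⟩ : ℂ) /
      (⟨(P.vtx (i + 1) - P.vtx i) 0, (P.vtx (i + 1) - P.vtx i) 1⟩ : ℂ))


/-- Summing closed-square relations along a column `m` of a grid relates the vertical increments in
the columns `m` and `m + 1`. -/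
theorem grid_column_shift {h v : ℕ → ℕ → ℝ} {l m : ℕ} (k : ℕ) (hlk : l ≤ k)
    (sq : ∀ i, l ≤ i → i < k → v i m + h (i + 1) m = h i m + v i (m + 1)) :
    h l m + ∑ i ∈ Finset.Ico l k, v i (m + 1) = ∑ i ∈ Finset.Ico l k, v i m + h k m := by
  induction k, hlk using Nat.le_induction with
  | base => simp
  | succ k hk ih =>
    rw [Finset.sum_Ico_succ_top hk, Finset.sum_Ico_succ_top hk]
    have h1 := ih fun i hi hik => sq i hi (by omega)
    have h2 := sq k hk (by omega)
    linarith

/-- If increments on a triangular grid add up to zero around each square and triangle, the sum along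
a staircase just above the diagonal equals the sum along the first row and the last column. -/
theorem grid_path_sum {N : ℕ} {h v : ℕ → ℕ → ℝ} {d : ℕ → ℝ}
    (sq : ∀ i j, i + 1 < j → j < N → v i j + h (i + 1) j = h i j + v i (j + 1))
    (tri : ∀ i, i + 2 ≤ N → h i (i + 1) + v i (i + 2) = d i) (m : ℕ) (hm : m + 2 ≤ N) :
    ∑ j ∈ Finset.Ico 1 (m + 2), h 0 j + ∑ i ∈ Finset.Ico 0 (m + 1), v i (m + 2) =
      ∑ i ∈ Finset.range (m + 1), d i := by
  induction m with
  | zero => simpa using tri 0 hm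
  | succ m ih =>
    have h1 := ih (by omega)
    have h2 := grid_column_shift (h := h) (v := v) (l := 0) (m := m + 2) (m + 1) (by omega)
      fun i _ hi => sq i (m + 2) (by omega) (by omega)
    have h3 := tri (m + 1) (by omega)
    rw [Finset.sum_range_succ, ← h1, ← h3, Finset.sum_Ico_succ_top (by omega : 1 ≤ m + 2),
      Finset.sum_Ico_succ_top (by omega : 0 ≤ m + 1)]
    ring_nf at h2 ⊢
    linarith

/-- The variant of `grid_path_sum` for a grid with the corner `(0, N + 1)` removed. -/
theorem grid_boundary_sum {N : ℕ} (hN : 2 ≤ N) {h v : ℕ → ℕ → ℝ} {d : ℕ → ℝ}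
    (sq : ∀ i j, i + 1 < j → j ≤ N → (i ≠ 0 ∨ j ≠ N) →
      v i j + h (i + 1) j = h i j + v i (j + 1))
    (tri : ∀ i, i + 1 ≤ N → h i (i + 1) + v i (i + 2) = d i) :
    ∑ i ∈ Finset.range N, d i =
      ∑ j ∈ Finset.Ico 1 N, h 0 j + (v 0 N + h 1 N) + ∑ i ∈ Finset.Ico 1 N, v i (N + 1) := by
  obtain ⟨m, rfl⟩ : ∃ m, N = m + 2 := ⟨N - 2, by omega⟩
  have h1 := grid_path_sum (N := m + 2) (fun i j hij hj => sq i j hij hj.le (Or.inr hj.ne))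
    (fun i hi => tri i (by omega)) m le_rfl
  have h2 := grid_column_shift (h := h) (v := v) (l := 1) (m := m + 2) (m + 1) (by omega)
    fun i hi hk => sq i (m + 2) (by omega) le_rfl (Or.inl (by omega))
  have h3 := tri (m + 1) (by omega)
  rw [Finset.sum_range_succ, ← h1, ← h3, Finset.sum_eq_sum_Ico_succ_bot (by omega : 0 < m + 1),
    Finset.sum_Ico_succ_top (by omega : 1 ≤ m + 1)  (fun i => v i (m + 2 + 1))]
  ring_nf at h2 ⊢
  linarith

theorem arg_div_eq_sub {c z w : ℂ} (hz : 0 < (c * z).re) (hw : 0 < (c * w).re) :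
    (w / z).arg = (c * w).arg - (c * z).arg := by
  have hc : c ≠ 0 := by rintro rfl; simp at hz
  have hz0 : c * z ≠ 0 := fun h => by simp [h] at hz
  have hw0 : c * w ≠ 0 := fun h => by simp [h] at hw
  have h1 := Complex.abs_arg_lt_pi_div_two_iff.2 (Or.inl hz)
  have h2 := Complex.abs_arg_lt_pi_div_two_iff.2 (Or.inl hw)
  rw [abs_lt] at h1 h2
  have h3 : (w / z) = (c * w) / (c * z) := by rw [mul_div_mul_left _ _ hc]
  have h4 : ((w / z).arg : Real.Angle) = (((c * w).arg - (c * z).arg : ℝ) : Real.Angle) := by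
    rw [h3, Complex.arg_div_coe_angle hw0 hz0, Real.Angle.coe_sub]
  have h5 := congrArg Real.Angle.toReal h4
  rwa [Complex.arg_coe_angle_toReal_eq_arg,
    Real.Angle.toReal_coe_eq_self_iff_mem_Ioc.2 ⟨by linarith, by linarith⟩] at h5

theorem exists_re_mul_pos_of_disjoint_segment {a b a' b' : ℂ}
    (h : Disjoint (segment ℝ a b) (segment ℝ a' b')) :
    ∃ c : ℂ, ∀ x ∈ segment ℝ a b, ∀ y ∈ segment ℝ a' b', 0 < (c * (y - x)).re := by
  have hc : ∀ x y : ℂ, IsCompact (segment ℝ x y) := fun x y => by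
    rw [segment_eq_image]
    exact isCompact_Icc.image (by fun_prop)
  obtain ⟨f, u, v, hu, huv, hv⟩ := geometric_hahn_banach_compact_closed (convex_segment a b)
    (hc a b) (convex_segment a' b') (hc a' b').isClosed h
  refine ⟨⟨f 1, -f Complex.I⟩, fun x hx y hy => ?_⟩
  have h1 : ∀ z : ℂ, f z = z.re * f 1 + z.im * f Complex.I := fun z => by
    conv_lhs => rw [← Complex.re_add_im z]
    have : ((z.re : ℂ) + z.im * Complex.I) = z.re • (1 : ℂ) + z.im • Complex.I := by simp
    rw [this, map_add, map_smul, map_smul, smul_eq_mul, smul_eq_mul]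
  have h2 := hu x hx
  have h3 := hv y hy
  rw [h1] at h2 h3
  simp only [Complex.mul_re, Complex.sub_re, Complex.sub_im]
  linarith

/-- The distance on the real line is conditionally of negative type. -/
theorem sum_sum_mul_abs_sub_nonpos {ι : Type*} (t : Finset ι) (s y : ι → ℝ)
    (hs : ∑ i ∈ t, s i = 0) : ∑ i ∈ t, ∑ j ∈ t, s i * s j * |y i - y j| ≤ 0 := by
  have h1 : ∀ a b : ℝ, |a - b| = ∫ x, (Set.uIoc b a).indicator (fun _ => (1 : ℝ)) x := by
    intro a b
    rw [MeasureTheory.integral_indicator measurableSet_uIoc]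
    simp [Set.uIoc, MeasureTheory.measureReal_def, max_sub_min_eq_abs]
  have hint : ∀ a b : ℝ, MeasureTheory.Integrable
      (fun x => (Set.uIoc b a).indicator (fun _ => (1 : ℝ)) x) := by
    intro a b
    rw [MeasureTheory.integrable_indicator_iff measurableSet_uIoc]
    simp [Set.uIoc]
  have h2 : ∑ i ∈ t, ∑ j ∈ t, s i * s j * |y i - y j| =
      ∫ x, ∑ i ∈ t, ∑ j ∈ t,
        s i * s j * (Set.uIoc (y j) (y i)).indicator (fun _ => (1 : ℝ)) x := by
    rw [MeasureTheory.integral_finsetSum _ fun i _ =>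
      MeasureTheory.integrable_finsetSum _ fun j _ => (hint _ _).const_mul _]
    refine Finset.sum_congr rfl fun i _ => ?_
    rw [MeasureTheory.integral_finsetSum _ fun j _ => (hint _ _).const_mul _]
    refine Finset.sum_congr rfl fun j _ => ?_
    rw [MeasureTheory.integral_const_mul, h1]
  rw [h2]
  refine MeasureTheory.integral_nonpos fun x => ?_
  set u : ι → ℝ := fun i => if y i < x then 1 else 0 with hu
  have h3 : ∀ i j, (Set.uIoc (y j) (y i)).indicator (fun _ => (1 : ℝ)) x =
      u i + u j - 2 * u i * u j := by
    intro i j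
    by_cases hx : x ∈ Set.uIoc (y j) (y i)
    · rw [Set.indicator_of_mem hx]
      rw [Set.mem_uIoc] at hx
      simp only [hu]
      grind
    · rw [Set.indicator_of_notMem hx]
      rw [Set.mem_uIoc] at hx
      simp only [hu]
      grind
  have h4 : ∑ i ∈ t, ∑ j ∈ t,
        s i * s j * (Set.uIoc (y j) (y i)).indicator (fun _ => (1 : ℝ)) x =
      2 * (∑ i ∈ t, s i * u i) * (∑ i ∈ t, s i) - 2 * (∑ i ∈ t, s i * u i) ^ 2 := by
    have e1 : (∑ i ∈ t, s i * u i) * (∑ i ∈ t, s i) =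
      ∑ i ∈ t, ∑ j ∈ t, s i * u i * s j := Finset.sum_mul_sum ..
    have e2 : (∑ i ∈ t, s i) * (∑ i ∈ t, s i * u i) =
      ∑ i ∈ t, ∑ j ∈ t, s i * (s j * u j) := Finset.sum_mul_sum ..
    have e3 : (∑ i ∈ t, s i * u i) * (∑ i ∈ t, s i * u i) =
      ∑ i ∈ t, ∑ j ∈ t, s i * u i * (s j * u j) := Finset.sum_mul_sum ..
    have : 2 * (∑ i ∈ t, s i * u i) * (∑ i ∈ t, s i) - 2 * (∑ i ∈ t, s i * u i) ^ 2 =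
      (∑ i ∈ t, s i * u i) * (∑ i ∈ t, s i) + (∑ i ∈ t, s i) * (∑ i ∈ t, s i * u i)
       - 2 * ((∑ i ∈ t, s i * u i) * (∑ i ∈ t, s i * u i)) := by ring
    rw [this, e1, e2, e3]
    simp only [Finset.mul_sum, ← Finset.sum_add_distrib, ← Finset.sum_sub_distrib]
    refine Finset.sum_congr rfl fun i _ => Finset.sum_congr rfl fun j _ => ?_
    rw [h3]; ring
  simp only [h4, hs, Pi.zero_apply]
  nlinarith [sq_nonneg (∑ i ∈ t, s i * u i)]

/-- The argument in `(-π/2, π/2)` of the line through `0` and `z`, for `z` off the imaginary axis. -/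
def lineArg (z : ℂ) : ℝ := if 0 < z.re then z.arg else (-z).arg

theorem lineArg_ofReal_mul_of_neg (z : ℂ) (hz : z.re ≠ 0) (t : ℝ) (ht : t < 0) :
    lineArg (t * z) = lineArg z := by
  have h : (t * z : ℂ) = ((-t : ℝ) : ℂ) * (-z) := by push_cast; ring
  unfold lineArg
  rcases lt_or_gt_of_ne hz with h0 | h0
  · rw [if_pos (by simp; nlinarith), if_neg h0.not_gt, h, Complex.arg_real_mul _ (by linarith)]
  · rw [if_neg (by simp; nlinarith), if_pos h0, h, mul_neg, neg_neg,
      Complex.arg_real_mul _ (by linarith)]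

/-- The angle from `a` to `b` in terms of how the segment `[a, b]` crosses the imaginary axis. -/
theorem arg_div_eq_lineArg_sub (a b : ℂ) (ha : a.re ≠ 0) (hb : b.re ≠ 0)
    (hab : a.re < 0 ∧ 0 < b.re ∨ b.re < 0 ∧ 0 < a.re → a.re * b.im - a.im * b.re ≠ 0) :
    (b / a).arg = lineArg b - lineArg a + Real.pi *
      (((if a.re < 0 then 1 else 0) - (if b.re < 0 then 1 else 0)) *
        Real.sign ((a.re * b.im - a.im * b.re) / (b.re - a.re))) := by
  have him : ∀ z w : ℂ, (z / w).im = (w.re * z.im - w.im * z.re) / Complex.normSq w := by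
    intro z w; rw [Complex.div_im]; ring
  unfold lineArg
  rcases lt_or_gt_of_ne ha with h1 | h1 <;> rcases lt_or_gt_of_ne hb with h2 | h2
  · rw [arg_div_eq_sub (c := -1) (by simpa) (by simpa)]
    simp [h1, h2, h1.not_gt, h2.not_gt]
  · have h3 := arg_div_eq_sub (c := 1) (z := -a) (w := b) (by simpa) (by simpa)
    have h4 : b / a = -(b / -a) := by rw [div_neg, neg_neg]
    have hn : 0 < Complex.normSq (-a) := Complex.normSq_pos.2 (by rintro h; simp_all)
    simp only [h1, h2, h1.not_gt, h2.not_gt, if_true, if_false]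
    rcases lt_or_gt_of_ne (hab (Or.inl ⟨h1, h2⟩)) with h5 | h5
    · rw [Real.sign_of_neg (div_neg_of_neg_of_pos h5 (by linarith)), h4,
        Complex.arg_neg_eq_arg_sub_pi_of_im_pos (by
          rw [him]; apply div_pos _ hn; simp; linarith), h3]
      simp; ring
    · rw [Real.sign_of_pos (div_pos h5 (by linarith)), h4,
        Complex.arg_neg_eq_arg_add_pi_of_im_neg (by
          rw [him]; apply div_neg_of_neg_of_pos _ hn; simp; linarith), h3]
      simp
  · have h3 := arg_div_eq_sub (c := 1) (z := a) (w := -b) (by simpa) (by simpa)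
    have h4 : b / a = -(-b / a) := by rw [neg_div, neg_neg]
    have hn : 0 < Complex.normSq a := Complex.normSq_pos.2 (by rintro h; simp_all)
    simp only [h1, h2, h1.not_gt, h2.not_gt, if_true, if_false]
    rcases lt_or_gt_of_ne (hab (Or.inr ⟨h2, h1⟩)) with h5 | h5
    · rw [Real.sign_of_pos (div_pos_of_neg_of_neg h5 (by linarith)), h4,
        Complex.arg_neg_eq_arg_sub_pi_of_im_pos (by
          rw [him]; apply div_pos _ hn; simp; linarith), h3]
      simp; ring
    · rw [Real.sign_of_neg (div_neg_of_pos_of_neg h5 (by linarith)), h4,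
        Complex.arg_neg_eq_arg_add_pi_of_im_neg (by
          rw [him]; apply div_neg_of_neg_of_pos _ hn; simp; linarith), h3]
      simp
  · rw [arg_div_eq_sub (c := 1) (by simpa) (by simpa)]
    simp [h1, h2, h1.not_gt, h2.not_gt]

theorem arg_square_eq {a a' b b' : ℂ} (h : Disjoint (segment ℝ a a') (segment ℝ b b')) :
    ((b - a') / (b - a)).arg + ((b' - a') / (b - a')).arg =
      ((b' - a) / (b - a)).arg + ((b' - a') / (b' - a)).arg := by
  obtain ⟨c, hc⟩ := exists_re_mul_pos_of_disjoint_segment h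
  have h1 := hc a (left_mem_segment ..) b (left_mem_segment ..)
  have h2 := hc a' (right_mem_segment ..) b (left_mem_segment ..)
  have h3 := hc a (left_mem_segment ..) b' (right_mem_segment ..)
  have h4 := hc a' (right_mem_segment ..) b' (right_mem_segment ..)
  rw [arg_div_eq_sub h1 h2, arg_div_eq_sub h2 h4, arg_div_eq_sub h1 h3, arg_div_eq_sub h3 h4]
  ring

theorem arg_triangle_eq {a b c : ℂ}
    (h : (b - a).re * (c - b).im - (b - a).im * (c - b).re ≠ 0) :
    ((c - a) / (b - a)).arg + ((c - b) / (c - a)).arg = ((c - b) / (b - a)).arg := by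
  have hd : Disjoint (segment ℝ (0 : ℂ) 0) (segment ℝ (b - a) (c - b)) := by
    rw [segment_same, Set.disjoint_singleton_left]
    rintro ⟨s, t, hs, ht, hst, h0⟩
    have hre := congrArg Complex.re h0
    have him := congrArg Complex.im h0
    simp only [Complex.add_re, Complex.smul_re, smul_eq_mul, Complex.add_im, Complex.smul_im,
      Complex.zero_re, Complex.zero_im] at hre him
    apply h
    linear_combination (-(b - a).re * (c - b).im + (b - a).im * (c - b).re) * hst +
      ((c - b).im - (b - a).im) * hre + ((b - a).re - (c - b).re) * him
  obtain ⟨w, hw⟩ := exists_re_mul_pos_of_disjoint_segment hd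
  have h1 := hw 0 (left_mem_segment ..) _ (left_mem_segment ..)
  have h2 := hw 0 (left_mem_segment ..) _ (right_mem_segment ..)
  rw [sub_zero] at h1 h2
  have h3 : 0 < (w * (c - a)).re := by
    have : w * (c - a) = w * (b - a) + w * (c - b) := by ring
    rw [this, Complex.add_re]
    exact add_pos h1 h2
  rw [arg_div_eq_sub h1 h3, arg_div_eq_sub h3 h2, arg_div_eq_sub h1 h2]
  ring

theorem arg_div_eq_zero_of_pos_mul {z w : ℂ} {t : ℝ} (ht : 0 ≤ t) (h : w = t * z) :
    (w / z).arg = 0 := by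
  rcases eq_or_ne z 0 with rfl | hz
  · simp
  · rw [h, mul_div_cancel_right₀ _ hz, Complex.arg_ofReal_of_nonneg ht]

theorem arg_ofReal_mul_div_ofReal_mul {z w : ℂ} {s t : ℝ} (hs : 0 < s) (ht : 0 < t) :
    ((t * w) / (s * z)).arg = (w / z).arg := by
  have : (t * w) / (s * z) = ((t / s : ℝ) : ℂ) * (w / z) := by
    push_cast
    rw [mul_div_mul_comm]
  rw [this, Complex.arg_real_mul _ (div_pos ht hs)]

/-- A closed polygonal path in the complex plane, given by an `n`-periodic sequence of vertices,
whose edges meet only at common endpoints and none of whose vertices is flat. -/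
structure IsSimpleClosedPath (V : ℕ → ℂ) (n : ℕ) : Prop where
  three_le : 3 ≤ n
  periodic : ∀ i, V (i + n) = V i
  inter : ∀ i j, i < j → j < i + n → ∀ z ∈ segment ℝ (V i) (V (i + 1)),
    z ∈ segment ℝ (V j) (V (j + 1)) → (j = i + 1 ∧ z = V j) ∨ (j + 1 = i + n ∧ z = V i)
  det_ne_zero : ∀ i, (V (i + 1) - V i).re * (V (i + 2) - V (i + 1)).im -
    (V (i + 1) - V i).im * (V (i + 2) - V (i + 1)).re ≠ 0

namespace IsSimpleClosedPath

variable {V : ℕ → ℂ} {n : ℕ}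

theorem ne_succ (hV : IsSimpleClosedPath V n) (i : ℕ) : V i ≠ V (i + 1) := fun h =>
  hV.det_ne_zero i (by simp [h])

/-- Hopf's rotation theorem, relative to a base point `p` in the interior of an edge. -/
theorem sum_arg_turn_eq (hV : IsSimpleClosedPath V n) (i₀ : ℕ) {p : ℂ}
    (hp : p ∈ openSegment ℝ (V i₀) (V (i₀ + 1))) :
    ∑ k ∈ Finset.range n, ((V (i₀ + k + 2) - V (i₀ + k + 1)) / (V (i₀ + k + 1) - V (i₀ + k))).arg =
      2 * ∑ k ∈ Finset.Ico 1 n, ((V (i₀ + k + 1) - p) / (V (i₀ + k) - p)).arg := by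
  have hn := hV.three_le
  have hper : V (i₀ + n) = V i₀ := hV.periodic i₀
  have hper1 : V (i₀ + n + 1) = V (i₀ + 1) := by rw [← hV.periodic (i₀ + 1)]; congr 1; omega
  have hne := hV.ne_succ i₀
  have hps : p ∈ segment ℝ (V i₀) (V (i₀ + 1)) := openSegment_subset_segment _ _ _ hp
  obtain ⟨s, t, hs, ht, hst, hpe⟩ := hp
  have hpe1 : V (i₀ + 1) - p = s * (V (i₀ + 1) - V i₀) := by
    rw [← hpe, Complex.real_smul, Complex.real_smul]
    have : (s : ℂ) + t = 1 := by exact_mod_cast hst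
    linear_combination (-V (i₀ + 1)) * this
  have hpe2 : p - V i₀ = t * (V (i₀ + 1) - V i₀) := by
    rw [← hpe, Complex.real_smul, Complex.real_smul]
    have : (s : ℂ) + t = 1 := by exact_mod_cast hst
    linear_combination (V i₀) * this
  have hleft : V i₀ ∉ segment ℝ p (V (i₀ + 1)) := by
    rintro ⟨c, d, hc, hd, hcd, h⟩
    rw [Complex.real_smul, Complex.real_smul] at h
    have hcd' : (c : ℂ) + d = 1 := by exact_mod_cast hcd
    have h1 : ((c * s - 1 : ℝ) : ℂ) * (V (i₀ + 1) - V i₀) = 0 := by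
      push_cast
      linear_combination (-c : ℂ) * hpe1 - h + V (i₀ + 1) * hcd'
    rcases mul_eq_zero.1 h1 with h2 | h2
    · have h3 : c * s - 1 = 0 := by exact_mod_cast h2
      nlinarith
    · exact hne (sub_eq_zero.1 h2).symm
  have hright : V (i₀ + 1) ∉ segment ℝ (V i₀) p := by
    rintro ⟨c, d, hc, hd, hcd, h⟩
    rw [Complex.real_smul, Complex.real_smul] at h
    have hcd' : (c : ℂ) + d = 1 := by exact_mod_cast hcd
    have h1 : ((d * t - 1 : ℝ) : ℂ) * (V (i₀ + 1) - V i₀) = 0 := by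
      push_cast
      linear_combination (-d : ℂ) * hpe2 + h - V i₀ * hcd'
    rcases mul_eq_zero.1 h1 with h2 | h2
    · have h3 : d * t - 1 = 0 := by exact_mod_cast h2
      nlinarith
    · exact hne (sub_eq_zero.1 h2).symm
  set q : ℕ → ℂ := fun k => if k = 0 then p else if k = n + 1 then p else V (i₀ + k) with hq
  have q0 : q 0 = p := by simp [hq]
  have qlast : q (n + 1) = p := by simp [hq]
  have qmid : ∀ k, 1 ≤ k → k ≤ n → q k = V (i₀ + k) := fun k h1 h2 => by
    simp only [hq]
    rw [if_neg (by omega), if_neg (by omega)]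
  have qsub : ∀ k ≤ n, segment ℝ (q k) (q (k + 1)) ⊆ segment ℝ (V (i₀ + k)) (V (i₀ + k + 1)) := by
    intro k hk
    rcases Nat.eq_zero_or_pos k with rfl | hk0
    · rw [q0, qmid 1 le_rfl (by omega)]
      exact (convex_segment _ _).segment_subset hps (right_mem_segment ..)
    · rcases hk.lt_or_eq with hk1 | rfl
      · rw [qmid k hk0 hk, qmid (k + 1) (by omega) (by omega)]
        rfl
      · rw [qlast, qmid k hk0 le_rfl, hper1, hper]
        exact (convex_segment _ _).segment_subset (left_mem_segment ..) hps
  have hdisj : ∀ i j, i + 1 < j → j ≤ n → (i ≠ 0 ∨ j ≠ n) →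
      Disjoint (segment ℝ (q i) (q (i + 1))) (segment ℝ (q j) (q (j + 1))) := by
    intro i j hij hj h0
    rw [Set.disjoint_left]
    intro z hzi hzj
    have h1 := qsub i (by omega) hzi
    have h2 := qsub j hj hzj
    rcases hj.lt_or_eq with hj1 | rfl
    · rcases hV.inter (i₀ + i) (i₀ + j) (by omega) (by omega) z h1 h2 with ⟨h3, -⟩ | ⟨h3, h4⟩
      · omega
      · obtain rfl : i = 0 := by omega
        rw [q0, qmid 1 le_rfl (by omega), h4] at hzi
        exact hleft hzi
    · rw [hper, hper1] at h2
      rcases hV.inter i₀ (i₀ + i) (by omega) (by omega) z h2 h1 with ⟨h3, h4⟩ | ⟨h3, -⟩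
      · rw [qlast, qmid j (by omega) le_rfl, hper, h4] at hzj
        obtain rfl : i = 1 := by omega
        exact hright hzj
      · omega
  have hstep : ∀ k ≤ n, ∃ r : ℝ, 0 < r ∧ q (k + 1) - q k = r * (V (i₀ + k + 1) - V (i₀ + k)) := by
    intro k hk
    rcases Nat.eq_zero_or_pos k with rfl | hk0
    · exact ⟨s, hs, by rw [q0, qmid 1 le_rfl (by omega)]; exact hpe1⟩
    · rcases hk.lt_or_eq with hk1 | rfl
      · exact ⟨1, one_pos, by
          rw [qmid k hk0 hk, qmid (k + 1) (by omega) (by omega)]; simp [add_assoc]⟩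
      · exact ⟨t, ht, by rw [qlast, qmid k hk0 le_rfl, hper1, hper]; exact hpe2⟩
  have hgrid := grid_boundary_sum (N := n) (by omega)
    (h := fun i j => ((q (j + 1) - q i) / (q j - q i)).arg)
    (v := fun i j => ((q j - q (i + 1)) / (q j - q i)).arg)
    (d := fun i => ((V (i₀ + i + 2) - V (i₀ + i + 1)) / (V (i₀ + i + 1) - V (i₀ + i))).arg)
    (fun i j hij hj h0 => arg_square_eq (hdisj i j hij hj h0))
    (fun i hi => by
      obtain ⟨r, hr, h1⟩ := hstep i (by omega)
      obtain ⟨r', hr', h2⟩ := hstep (i + 1) hi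
      rw [show i₀ + (i + 1) + 1 = i₀ + i + 2 by ring, show i₀ + (i + 1) = i₀ + i + 1 by ring] at h2
      rw [← arg_ofReal_mul_div_ofReal_mul (z := V (i₀ + i + 1) - V (i₀ + i)) hr hr', ← h1, ← h2]
      apply arg_triangle_eq
      rw [h1, show q (i + 2) - q (i + 1) = _ from h2]
      simp only [Complex.re_ofReal_mul, Complex.im_ofReal_mul]
      have := mul_ne_zero (mul_ne_zero hr.ne' hr'.ne') (hV.det_ne_zero (i₀ + i))
      convert this using 1
      ring)
  rw [hgrid]
  have e1 : ((q n - q (0 + 1)) / (q n - q 0)).arg = 0 := by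
    rw [q0, zero_add, qmid n (by omega) le_rfl, qmid 1 le_rfl (by omega), hper]
    refine arg_div_eq_zero_of_pos_mul (t := 1 / t) (by positivity) ?_
    have : (t : ℂ) ≠ 0 := by exact_mod_cast ht.ne'
    push_cast
    field_simp
    linear_combination hpe2
  have e2 : ((q (n + 1) - q 1) / (q n - q 1)).arg = 0 := by
    rw [qlast, qmid n (by omega) le_rfl, qmid 1 le_rfl (by omega), hper]
    exact arg_div_eq_zero_of_pos_mul hs.le (by linear_combination -hpe1)
  rw [e1, e2, two_mul, add_zero, add_zero]
  congr 1
  · refine Finset.sum_congr rfl fun k hk => ?_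
    rw [Finset.mem_Ico] at hk
    rw [q0, qmid k hk.1 hk.2.le, qmid (k + 1) (by omega) (by omega), add_assoc]
  · refine Finset.sum_congr rfl fun k hk => ?_
    rw [Finset.mem_Ico] at hk
    rw [qlast, qmid k hk.1 hk.2.le, qmid (k + 1) (by omega) (by omega), ← neg_sub, ← neg_sub _ p,
      neg_div_neg_eq, add_assoc]

end IsSimpleClosedPath

/-- The signed crossing number of the edge `[V j, V (j + 1)]` with the vertical line through `x`:
`1` if the edge crosses the line from left to right, `-1` if from right to left, `0` if not. -/
def crossSign (V : ℕ → ℂ) (x : ℝ) (j : ℕ) : ℝ :=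
  (if (V j).re < x then 1 else 0) - (if (V (j + 1)).re < x then 1 else 0)

/-- The ordinate at abscissa `x` of the line through `V j` and `V (j + 1)`. -/
def edgeHeight (V : ℕ → ℂ) (x : ℝ) (j : ℕ) : ℝ :=
  (V j).im + (x - (V j).re) * (((V (j + 1)).im - (V j).im) / ((V (j + 1)).re - (V j).re))

theorem sum_range_add_of_periodic {f : ℕ → ℝ} {n : ℕ} (hf : ∀ i, f (i + n) = f i) (i₀ : ℕ) :
    ∑ k ∈ Finset.range n, f (i₀ + k) = ∑ k ∈ Finset.range n, f k := by
  induction i₀ with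
  | zero => simp
  | succ m ih =>
    rw [← ih]
    have h1 := Finset.sum_range_succ (fun k => f (m + k)) n
    have h2 := Finset.sum_range_succ' (fun k => f (m + k)) n
    rw [h1, hf, add_zero] at h2
    simpa [add_assoc, add_comm 1] using (add_right_cancel h2).symm

theorem sub_ne_zero_of_crossSign_ne_zero {V : ℕ → ℂ} {x : ℝ} {j : ℕ} (h : crossSign V x j ≠ 0) :
    (V (j + 1)).re - (V j).re ≠ 0 := by
  intro h0
  apply h
  rw [crossSign, sub_eq_zero.1 h0, sub_self]

theorem mem_openSegment_of_crossSign_ne_zero {V : ℕ → ℂ} {x : ℝ} {j : ℕ}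
    (hx : ∀ k, (V k).re ≠ x) (h : crossSign V x j ≠ 0) :
    (⟨x, edgeHeight V x j⟩ : ℂ) ∈ openSegment ℝ (V j) (V (j + 1)) := by
  have hd := sub_ne_zero_of_crossSign_ne_zero h
  have h0 := hx j
  have h1 := hx (j + 1)
  have ht : 0 < (x - (V j).re) / ((V (j + 1)).re - (V j).re) ∧
      0 < ((V (j + 1)).re - x) / ((V (j + 1)).re - (V j).re) := by
    unfold crossSign at h
    rcases lt_or_gt_of_ne h0 with h0 | h0 <;> rcases lt_or_gt_of_ne h1 with h1 | h1
    · simp [h0, h1] at h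
    · exact ⟨div_pos (by linarith) (by linarith), div_pos (by linarith) (by linarith)⟩
    · exact ⟨div_pos_of_neg_of_neg (by linarith) (by linarith),
        div_pos_of_neg_of_neg (by linarith) (by linarith)⟩
    · simp [h0.not_gt, h1.not_gt] at h
  refine ⟨_, _, ht.2, ht.1, by field_simp; ring, ?_⟩
  apply Complex.ext
  · simp only [Complex.add_re, Complex.smul_re, smul_eq_mul]
    field_simp
    ring
  · simp only [Complex.add_im, Complex.smul_im, smul_eq_mul, edgeHeight]
    field_simp
    ring

theorem exists_between_forall_re_ne (V : ℕ → ℂ) {a b : ℝ} (hab : a < b) :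
    ∃ x, a < x ∧ x < b ∧ ∀ k, (V k).re ≠ x := by
  obtain ⟨x, hx, hx'⟩ := ((Set.countable_range fun k => (V k).re).dense_compl ℝ).exists_between hab
  exact ⟨x, hx'.1, hx'.2, fun k hk => hx ⟨k, hk⟩⟩

theorem crossSign_eq_or (V : ℕ → ℂ) (x : ℝ) (j : ℕ) :
    crossSign V x j = 0 ∨ crossSign V x j = 1 ∨ crossSign V x j = -1 := by
  unfold crossSign
  split_ifs <;> norm_num

theorem integral_crossSign_mul_edgeHeight (V : ℕ → ℂ) (j : ℕ) :
    MeasureTheory.Integrable (fun x => crossSign V x j * edgeHeight V x j) ∧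
    ∫ x, crossSign V x j * edgeHeight V x j =
      ((V (j + 1)).re - (V j).re) * ((V j).im + (V (j + 1)).im) / 2 := by
  set a := (V j).re
  set b := (V (j + 1)).re
  set f : ℝ → ℝ := fun x => edgeHeight V x j with hf
  have hc : Continuous f := by
    simp only [hf, edgeHeight]
    fun_prop
  have heq : (fun x => crossSign V x j * edgeHeight V x j) =
      fun x => (Set.Ioc a b).indicator f x - (Set.Ioc b a).indicator f x := by
    funext x
    simp only [Set.indicator, Set.mem_Ioc, crossSign, hf]
    grind
  have h1 : MeasureTheory.Integrable ((Set.Ioc a b).indicator f) :=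
    (MeasureTheory.integrable_indicator_iff measurableSet_Ioc).2 (hc.integrableOn_Ioc)
  have h2 : MeasureTheory.Integrable ((Set.Ioc b a).indicator f) :=
    (MeasureTheory.integrable_indicator_iff measurableSet_Ioc).2 (hc.integrableOn_Ioc)
  rw [heq]
  refine ⟨h1.sub h2, ?_⟩
  rw [MeasureTheory.integral_sub h1 h2, MeasureTheory.integral_indicator measurableSet_Ioc,
    MeasureTheory.integral_indicator measurableSet_Ioc, ← intervalIntegral]
  have hi : ∫ x in a..b, f x = (V j).im * (b - a) +
      ((b ^ 2 - a ^ 2) / 2 - a * (b - a)) * (((V (j + 1)).im - (V j).im) / (b - a)) := by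
    simp only [hf, edgeHeight]
    rw [intervalIntegral.integral_add (by simp) (Continuous.intervalIntegrable (by fun_prop) _ _),
      intervalIntegral.integral_mul_const, intervalIntegral.integral_sub (by simp) (by simp)]
    simp
    ring
  rw [hi]
  by_cases hab : b - a = 0
  · rw [hab]
    simp
  · field_simp
    ring

namespace IsSimpleClosedPath

variable {V : ℕ → ℂ} {n : ℕ}

theorem crossSign_add (hV : IsSimpleClosedPath V n) (x : ℝ) (j : ℕ) :
    crossSign V x (j + n) = crossSign V x j := by
  rw [crossSign, crossSign, hV.periodic, add_right_comm, hV.periodic]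

theorem edgeHeight_add (hV : IsSimpleClosedPath V n) (x : ℝ) (j : ℕ) :
    edgeHeight V x (j + n) = edgeHeight V x j := by
  rw [edgeHeight, edgeHeight, hV.periodic, add_right_comm, hV.periodic]

theorem edgeHeight_ne (hV : IsSimpleClosedPath V n) {x : ℝ} (hx : ∀ k, (V k).re ≠ x) {i j : ℕ}
    (hij : i < j) (hji : j < i + n) (hi : crossSign V x i ≠ 0) (hj : crossSign V x j ≠ 0) :
    edgeHeight V x i ≠ edgeHeight V x j := by
  intro h
  have h1 := openSegment_subset_segment _ _ _ (mem_openSegment_of_crossSign_ne_zero hx hi)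
  have h2 := openSegment_subset_segment _ _ _ (mem_openSegment_of_crossSign_ne_zero hx hj)
  rw [← h] at h2
  rcases hV.inter i j hij hji _ h1 h2 with ⟨-, h3⟩ | ⟨-, h3⟩
  · exact hx j (congrArg Complex.re h3).symm
  · exact hx i (congrArg Complex.re h3).symm

theorem arg_div_eq_crossSign (hV : IsSimpleClosedPath V n) {x : ℝ} (hx : ∀ k, (V k).re ≠ x)
    {i j : ℕ} (hij : i < j) (hji : j < i + n) (hi : crossSign V x i ≠ 0) :
    ((V (j + 1) - ⟨x, edgeHeight V x i⟩) / (V j - ⟨x, edgeHeight V x i⟩)).arg =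
      lineArg (V (j + 1) - ⟨x, edgeHeight V x i⟩) - lineArg (V j - ⟨x, edgeHeight V x i⟩) +
        Real.pi * (crossSign V x j * Real.sign (edgeHeight V x i - edgeHeight V x j)) := by
  have hcs : crossSign V x j = (if (V j - ⟨x, edgeHeight V x i⟩).re < 0 then 1 else 0) -
      (if (V (j + 1) - ⟨x, edgeHeight V x i⟩).re < 0 then 1 else 0) := by
    simp [crossSign]
  have hdet : crossSign V x j ≠ 0 →
      ((V j - ⟨x, edgeHeight V x i⟩).re * (V (j + 1) - ⟨x, edgeHeight V x i⟩).im -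
        (V j - ⟨x, edgeHeight V x i⟩).im * (V (j + 1) - ⟨x, edgeHeight V x i⟩).re) =
        (edgeHeight V x i - edgeHeight V x j) *
          ((V (j + 1) - ⟨x, edgeHeight V x i⟩).re - (V j - ⟨x, edgeHeight V x i⟩).re) := by
    intro hj
    have hd := sub_ne_zero_of_crossSign_ne_zero hj
    generalize edgeHeight V x i = y
    simp only [Complex.sub_re, Complex.sub_im, edgeHeight]
    field_simp
    ring
  rw [arg_div_eq_lineArg_sub _ _ (by simpa [sub_eq_zero] using hx j)
    (by simpa [sub_eq_zero] using hx (j + 1)), ← hcs]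
  · congr 2
    by_cases hj : crossSign V x j = 0
    · simp [hj]
    · have hd := sub_ne_zero_of_crossSign_ne_zero hj
      rw [hdet hj, mul_div_cancel_right₀]
      simpa using hd
  · intro h
    have hj : crossSign V x j ≠ 0 := by
      rw [hcs]
      rcases h with ⟨h1, h2⟩ | ⟨h1, h2⟩
      · rw [if_pos h1, if_neg h2.not_gt]; norm_num
      · rw [if_pos h1, if_neg h2.not_gt]; norm_num
    have hd := sub_ne_zero_of_crossSign_ne_zero hj
    rw [hdet hj]
    refine mul_ne_zero (sub_ne_zero.2 (hV.edgeHeight_ne hx hij hji hi hj)) ?_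
    simpa using hd

theorem sum_arg_turn_eq_crossSign (hV : IsSimpleClosedPath V n) {x : ℝ} (hx : ∀ k, (V k).re ≠ x)
    {i : ℕ} (hi : crossSign V x i ≠ 0) :
    ∑ k ∈ Finset.range n, ((V (k + 2) - V (k + 1)) / (V (k + 1) - V k)).arg =
      2 * Real.pi * ∑ j ∈ Finset.range n,
        crossSign V x j * Real.sign (edgeHeight V x i - edgeHeight V x j) := by
  have hn := hV.three_le
  have hp := mem_openSegment_of_crossSign_ne_zero hx hi
  rw [← sum_range_add_of_periodic (i₀ := i)
      (f := fun k => ((V (k + 2) - V (k + 1)) / (V (k + 1) - V k)).arg)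
      (fun k => by
        rw [add_right_comm, hV.periodic, add_right_comm, hV.periodic, hV.periodic]),
    ← sum_range_add_of_periodic (i₀ := i)
      (f := fun j => crossSign V x j * Real.sign (edgeHeight V x i - edgeHeight V x j))
      (fun j => by rw [hV.crossSign_add, hV.edgeHeight_add]),
    hV.sum_arg_turn_eq i hp, Finset.range_eq_Ico, Finset.sum_eq_sum_Ico_succ_bot (by omega : 0 < n),
    add_zero, sub_self, Real.sign_zero, mul_zero, zero_add, zero_add, mul_assoc]
  congr 1
  have h0 := Finset.sum_congr rfl fun k (hk : k ∈ Finset.Ico 1 n) =>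
    hV.arg_div_eq_crossSign (j := i + k) hx (by rw [Finset.mem_Ico] at hk; omega)
      (by rw [Finset.mem_Ico] at hk; omega) hi
  rw [h0, Finset.sum_add_distrib, ← Finset.mul_sum, add_eq_right]
  have h1 := Finset.sum_Ico_sub (fun k => lineArg (V (i + k) - ⟨x, edgeHeight V x i⟩))
    (by omega : 1 ≤ n)
  simp only [← add_assoc] at h1
  rw [h1, hV.periodic, sub_eq_zero]
  set p : ℂ := ⟨x, edgeHeight V x i⟩ with hpdef
  obtain ⟨s, t, hs, ht, hst, h⟩ := hp
  have hst' : (s : ℂ) + t = 1 := by exact_mod_cast hst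
  have ht' : (t : ℂ) ≠ 0 := by exact_mod_cast ht.ne'
  rw [Complex.real_smul, Complex.real_smul] at h
  have h2 : V (i + 1) - p = ((-(s / t) : ℝ) : ℂ) * (V i - p) := by
    push_cast
    field_simp
    linear_combination h - p * hst'
  rw [h2, lineArg_ofReal_mul_of_neg _ (by simpa [hpdef, sub_eq_zero] using hx i) _
    (by have := div_pos hs ht; linarith)]

theorem sum_crossSign (hV : IsSimpleClosedPath V n) (x : ℝ) :
    ∑ j ∈ Finset.range n, crossSign V x j = 0 := by
  unfold crossSign
  rw [Finset.sum_range_sub' (fun j => if (V j).re < x then (1 : ℝ) else 0)]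
  have := hV.periodic 0
  rw [zero_add] at this
  rw [this, sub_self]

theorem sum_arg_turn_eq_or (hV : IsSimpleClosedPath V n) :
    ∑ k ∈ Finset.range n, ((V (k + 2) - V (k + 1)) / (V (k + 1) - V k)).arg = 2 * Real.pi ∨
      ∑ k ∈ Finset.range n, ((V (k + 2) - V (k + 1)) / (V (k + 1) - V k)).arg =
        -(2 * Real.pi) := by
  have hn := hV.three_le
  obtain ⟨i, hin, hi⟩ : ∃ i < n, (V i).re ≠ (V (i + 1)).re := by
    by_contra! hc
    apply hV.det_ne_zero 0
    have h0 := hc 0 (by omega)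
    have h1 := hc 1 (by omega)
    simp only [zero_add, Complex.sub_re, Complex.sub_im] at *
    rw [← h1, ← h0]
    simp
  obtain ⟨x, hx, hxi⟩ : ∃ x, (∀ k, (V k).re ≠ x) ∧ crossSign V x i ≠ 0 := by
    rcases lt_or_gt_of_ne hi with h | h
    · obtain ⟨x, h1, h2, h3⟩ := exists_between_forall_re_ne V h
      exact ⟨x, h3, by simp [crossSign, h1, h2.not_gt]⟩
    · obtain ⟨x, h1, h2, h3⟩ := exists_between_forall_re_ne V h
      exact ⟨x, h3, by simp [crossSign, h1, h2.not_gt]⟩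
  obtain ⟨m, hm, hmax⟩ := Finset.exists_max_image
    ((Finset.range n).filter fun j => crossSign V x j ≠ 0) (edgeHeight V x)
    ⟨i, by simp [hin, hxi]⟩
  rw [Finset.mem_filter, Finset.mem_range] at hm
  have hsum : ∑ j ∈ Finset.range n,
      crossSign V x j * Real.sign (edgeHeight V x m - edgeHeight V x j) = -crossSign V x m := by
    have h1 : ∀ j ∈ Finset.range n,
        crossSign V x j * Real.sign (edgeHeight V x m - edgeHeight V x j) =
          crossSign V x j - if j = m then crossSign V x m else 0 := by
      intro j hj
      rw [Finset.mem_range] at hj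
      by_cases hjm : j = m
      · simp [hjm]
      rw [if_neg hjm, sub_zero]
      by_cases h0 : crossSign V x j = 0
      · simp [h0]
      have hle := hmax j (by simp [hj, h0])
      have hne : edgeHeight V x j ≠ edgeHeight V x m := by
        rcases lt_or_gt_of_ne hjm with h | h
        · exact hV.edgeHeight_ne hx h (by omega) h0 hm.2
        · exact (hV.edgeHeight_ne hx h (by omega) hm.2 h0).symm
      rw [Real.sign_of_pos (sub_pos.2 (lt_of_le_of_ne hle hne)), mul_one]
    rw [Finset.sum_congr rfl h1, Finset.sum_sub_distrib, hV.sum_crossSign,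
      Finset.sum_ite_eq' , if_pos (Finset.mem_range.2 hm.1), zero_sub]
  rw [hV.sum_arg_turn_eq_crossSign hx hm.2, hsum]
  rcases crossSign_eq_or V x m with h | h | h
  · exact absurd h hm.2
  · right; rw [h]; ring
  · left; rw [h]; ring

theorem sum_crossSign_mul_edgeHeight_nonneg (hV : IsSimpleClosedPath V n)
    (hneg : ∑ k ∈ Finset.range n, ((V (k + 2) - V (k + 1)) / (V (k + 1) - V k)).arg =
      -(2 * Real.pi)) {x : ℝ} (hx : ∀ k, (V k).re ≠ x) :
    0 ≤ ∑ j ∈ Finset.range n, crossSign V x j * edgeHeight V x j := by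
  set s := crossSign V x
  set y := edgeHeight V x
  have h0 := sum_sum_mul_abs_sub_nonpos (Finset.range n) s y (hV.sum_crossSign x)
  have hk : ∀ i, s i ≠ 0 → ∑ j ∈ Finset.range n, s j * Real.sign (y i - y j) = -1 := by
    intro i hi
    have h1 := hV.sum_arg_turn_eq_crossSign hx hi
    rw [hneg] at h1
    have hpi : (2 * Real.pi) ≠ 0 := by positivity
    apply mul_left_cancel₀ hpi
    rw [← h1]; ring
  have habs : ∀ z : ℝ, |z| = Real.sign z * z := by
    intro z
    rcases lt_trichotomy z 0 with h | h | h
    · rw [abs_of_neg h, Real.sign_of_neg h]; ring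
    · simp [h]
    · rw [abs_of_pos h, Real.sign_of_pos h]; ring
  have h1 : ∑ i ∈ Finset.range n, ∑ j ∈ Finset.range n, s i * y i * (s j * Real.sign (y i - y j)) =
      -∑ j ∈ Finset.range n, s j * y j := by
    rw [← Finset.sum_neg_distrib]
    refine Finset.sum_congr rfl fun i _ => ?_
    rw [← Finset.mul_sum]
    by_cases hi : s i = 0
    · simp [hi]
    · rw [hk i hi]; ring
  have h3 := h1
  have h2 : ∑ i ∈ Finset.range n, ∑ j ∈ Finset.range n, s i * s j * |y i - y j| =
      ∑ i ∈ Finset.range n, ∑ j ∈ Finset.range n, s i * y i * (s j * Real.sign (y i - y j)) +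
      ∑ i ∈ Finset.range n, ∑ j ∈ Finset.range n, s j * y j * (s i * Real.sign (y j - y i)) := by
    rw [← Finset.sum_add_distrib]
    refine Finset.sum_congr rfl fun i _ => ?_
    rw [← Finset.sum_add_distrib]
    refine Finset.sum_congr rfl fun j _ => ?_
    rw [habs, ← neg_sub (y i) (y j), Real.sign_neg]
    ring
  rw [Finset.sum_comm] at h3
  rw [h2, h1, h3] at h0
  linarith

theorem sum_arg_turn_eq_two_pi (hV : IsSimpleClosedPath V n)
    (harea : 0 < ∑ i ∈ Finset.range n, ((V i).re * (V (i + 1)).im - (V i).im * (V (i + 1)).re)) :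
    ∑ k ∈ Finset.range n, ((V (k + 2) - V (k + 1)) / (V (k + 1) - V k)).arg = 2 * Real.pi := by
  rcases hV.sum_arg_turn_eq_or with h | h
  · exact h
  exfalso
  have h1 : 0 ≤ ∫ x, ∑ j ∈ Finset.range n, crossSign V x j * edgeHeight V x j := by
    apply MeasureTheory.integral_nonneg_of_ae
    have hae : ∀ᵐ x : ℝ, x ∉ Set.range fun k => (V k).re :=
      (Set.countable_range _).ae_notMem _
    filter_upwards [hae] with x hx
    exact hV.sum_crossSign_mul_edgeHeight_nonneg h fun k hk => hx ⟨k, hk⟩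
  rw [MeasureTheory.integral_finsetSum _ fun j _ => (integral_crossSign_mul_edgeHeight V j).1,
    Finset.sum_congr rfl fun j _ => (integral_crossSign_mul_edgeHeight V j).2] at h1
  have h2 := Finset.sum_range_sub (fun i => (V i).re * (V i).im) n
  have h3 := hV.periodic 0
  rw [zero_add] at h3
  rw [h3, sub_self] at h2
  have h4 : ∑ i ∈ Finset.range n, ((V i).re * (V (i + 1)).im - (V i).im * (V (i + 1)).re) =
      ∑ i ∈ Finset.range n, ((V (i + 1)).re * (V (i + 1)).im - (V i).re * (V i).im) -
        2 * ∑ i ∈ Finset.range n,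
          ((V (i + 1)).re - (V i).re) * ((V i).im + (V (i + 1)).im) / 2 := by
    rw [Finset.mul_sum, ← Finset.sum_sub_distrib]
    exact Finset.sum_congr rfl fun i _ => by ring
  rw [h4, h2] at harea
  linarith

end IsSimpleClosedPath

theorem mem_segment_of_complex {u v : Pt} {z : ℂ}
    (hz : z ∈ segment ℝ (⟨u 0, u 1⟩ : ℂ) ⟨v 0, v 1⟩) : !₂[z.re, z.im] ∈ segment ℝ u v := by
  obtain ⟨a, b, ha, hb, hab, rfl⟩ := hz
  refine ⟨a, b, ha, hb, hab, ?_⟩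
  ext k
  fin_cases k <;> simp

namespace SimplePolygon

/-- The vertices of a polygon as complex numbers. -/
def complexVtx (P : SimplePolygon) (i : ℕ) : ℂ := ⟨P.vtx i 0, P.vtx i 1⟩

theorem vtx_mod (P : SimplePolygon) (i : ℕ) : P.vtx (i % P.n) = P.vtx i :=
  Function.Periodic.map_mod_nat P.periodic i

theorem vtx_mod_succ (P : SimplePolygon) (i : ℕ) : P.vtx (i % P.n + 1) = P.vtx (i + 1) := by
  rw [← P.vtx_mod (i % P.n + 1), Nat.mod_add_mod, P.vtx_mod]

/-- A point common to two different edges of a simple polygon is their common endpoint. -/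
theorem eq_vtx_of_mem_edges (P : SimplePolygon) {i j : ℕ} (hij : i < j) (hji : j < i + P.n) {x : Pt}
    (hi : x ∈ segment ℝ (P.vtx i) (P.vtx (i + 1))) (hj : x ∈ segment ℝ (P.vtx j) (P.vtx (j + 1))) :
    (j = i + 1 ∧ x = P.vtx j) ∨ (j + 1 = i + P.n ∧ x = P.vtx i) := by
  have hn := P.three_le
  have hn0 : 0 < P.n := by omega
  set S := {k | k < P.n ∧ x ∈ segment ℝ (P.vtx k) (P.vtx (k + 1))} with hS
  have hfin : S.Finite := (Set.finite_lt_nat P.n).subset fun k hk => hk.1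
  have hmem : ∀ k, x ∈ segment ℝ (P.vtx k) (P.vtx (k + 1)) → k % P.n ∈ S := fun k hk =>
    ⟨Nat.mod_lt _ hn0, by rwa [P.vtx_mod, P.vtx_mod_succ]⟩
  have hmod : ∀ a b, a < b → b < a + P.n → a % P.n ≠ b % P.n := by
    intro a b hab hba h
    have h1 : P.n ∣ b - a := (Nat.modEq_iff_dvd' hab.le).1 h
    exact absurd (Nat.le_of_dvd (by omega) h1) (by omega)
  have hpair : S = {i % P.n, j % P.n} := by
    symm
    apply Set.eq_of_subset_of_ncard_le _ _ hfin
    · rintro k (rfl | rfl)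
      · exact hmem i hi
      · exact hmem j hj
    · rw [Set.ncard_pair (hmod i j hij hji)]
      exact P.simple x
  obtain ⟨k, hk, hxk⟩ := P.vtx_of_two x (by
    rw [← hS, hpair, Set.ncard_pair (hmod i j hij hji)])
  have hk1 : k ∈ S := ⟨hk, by rw [← hxk]; exact left_mem_segment ..⟩
  have hk2 : (k + P.n - 1) % P.n ∈ S := hmem _ (by
    rw [show k + P.n - 1 + 1 = k + P.n by omega, P.periodic, ← hxk]
    exact right_mem_segment ..)
  have hk3 : k % P.n = k := Nat.mod_eq_of_lt hk
  have hne : k ≠ (k + P.n - 1) % P.n := by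
    have h1 := hmod k (k + P.n - 1) (by omega) (by omega)
    rwa [hk3] at h1
  have hsucc : ((k + P.n - 1) % P.n + 1) % P.n = k := by
    rw [Nat.mod_add_mod, show k + P.n - 1 + 1 = k + P.n by omega, Nat.add_mod_right, hk3]
  rw [hpair] at hk1 hk2
  rcases hk1 with h1 | h1 <;> rcases hk2 with h2 | h2
  · exact absurd (h1.trans h2.symm) hne
  · right
    refine ⟨?_, by rw [hxk, h1, P.vtx_mod]⟩
    rw [h2, Nat.mod_add_mod] at hsucc
    by_contra hc
    have h3 : (j + 1) % P.n = i % P.n := hsucc.trans h1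
    exact hmod i (j + 1) (by omega) (by omega) h3.symm
  · left
    refine ⟨?_, by rw [hxk, h1, P.vtx_mod]⟩
    rw [h2, Nat.mod_add_mod] at hsucc
    by_contra hc
    have h3 : (i + 1) % P.n = j % P.n := hsucc.trans h1
    exact hmod (i + 1) j (by omega) (by omega) h3
  · exact absurd (h1.trans h2.symm) hne

theorem isSimpleClosedPath (P : SimplePolygon)
    (hnc : ∀ i < P.n, det2 (P.vtx (i + 1) - P.vtx i) (P.vtx (i + 2) - P.vtx (i + 1)) ≠ 0) :
    IsSimpleClosedPath P.complexVtx P.n where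
  three_le := P.three_le
  periodic i := by rw [complexVtx, complexVtx, P.periodic]
  inter i j hij hji z hi hj := by
    have h := P.eq_vtx_of_mem_edges hij hji (mem_segment_of_complex hi) (mem_segment_of_complex hj)
    have hz : ∀ k, !₂[z.re, z.im] = P.vtx k → z = P.complexVtx k := by
      intro k hk
      rw [complexVtx, ← hk]
      simp
    exact h.imp (And.imp_right (hz j)) (And.imp_right (hz i))
  det_ne_zero i := by
    have h := hnc (i % P.n) (Nat.mod_lt _ (by have := P.three_le; omega))
    have h2 : P.vtx (i % P.n + 2) = P.vtx (i + 2) := by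
      rw [← P.vtx_mod (i % P.n + 2), Nat.mod_add_mod, P.vtx_mod]
    rw [P.vtx_mod, P.vtx_mod_succ, h2] at h
    simpa [det2, complexVtx] using h

end SimplePolygon

/-- The signed angular turns of a counterclockwise simple polygon (no three
consecutive vertices collinear) sum up to `2π`. -/
theorem sum_turn_angles
    (P : SimplePolygon) (hccw : P.CCW)
    (hnc : ∀ i < P.n, det2 (P.vtx (i + 1) - P.vtx i) (P.vtx (i + 2) - P.vtx (i + 1)) ≠ 0) :
    ∑ i ∈ Finset.range P.n, turnAngle P i = 2 * Real.pi := by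
  have h := (P.isSimpleClosedPath hnc).sum_arg_turn_eq_two_pi hccw
  rw [← h]
  refine Finset.sum_congr rfl fun i _ => ?_
  rw [turnAngle]
  congr 1
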